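/- arXiv:1207.5780 — 2 statements merged into one kernel-verified Lean document; each statement's English description precedes it below -/
import Mathlib

section
/- Every maximal ideal m of the commutative ring A_0 is of the form m_p for some p : I → k, where m_p denotes the ideal of A_0 generated by the elements {t_i − p_i·1 : i ∈ I}. -/
set_option synthInstance.maxHeartbeats 1000000
set_option maxHeartbeats 4000000

noncomputable section

open MvPolynomial

universe u v

variable (k : Type u) (I : Type v) [Field k]

/-- Multiplication by the variable `x i` on the polynomial algebra `B`. -/
def Xop (i : I) : Module.End k (MvPolynomial I k) :=
  LinearMap.mulLeft k (MvPolynomial.X i)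

/-- The partial derivative `∂/∂x i` on the polynomial algebra `B`. -/
def Yop (i : I) : Module.End k (MvPolynomial I k) :=
  (MvPolynomial.pderiv i).toLinearMap

/-- The infinite Weyl algebra `A`: the subalgebra of `Module.End k B` generated by
all `X i` and `Y i`. -/
def Weyl : Subalgebra k (Module.End k (MvPolynomial I k)) :=
  Algebra.adjoin k (Set.range (Xop k I) ∪ Set.range (Yop k I))

instance : Ring (Weyl k I) := inferInstance
instance : Algebra k (Weyl k I) := inferInstance

/-- `X i` as an element of the Weyl algebra. -/
def XA (i : I) : Weyl k I :=
  ⟨Xop k I i, Algebra.subset_adjoin (Set.mem_union_left _ ⟨i, rfl⟩)⟩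

/-- `Y i` as an element of the Weyl algebra. -/
def YA (i : I) : Weyl k I :=
  ⟨Yop k I i, Algebra.subset_adjoin (Set.mem_union_right _ ⟨i, rfl⟩)⟩

/-- `t i = X i * Y i` as an element of the Weyl algebra. -/
def tA (i : I) : Weyl k I := XA k I i * YA k I i

/-- The subalgebra `A₀` of the Weyl algebra generated by the `t i`. -/
def A0 : Subalgebra k (Weyl k I) := Algebra.adjoin k (Set.range (tA k I))

instance : Ring (A0 k I) := inferInstance
instance : Algebra k (A0 k I) := inferInstance

/-- `t i` as an element of `A₀`. -/
def tA0 (i : I) : A0 k I := ⟨tA k I i, Algebra.subset_adjoin ⟨i, rfl⟩⟩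

universe w

/-- A field extension of an algebraically closed field `F` of rank smaller than `#F` is trivial. -/
theorem IsAlgClosed.algebraMap_surjective_of_lift_rank_lt {F : Type u} {E : Type v}
    [Field F] [IsAlgClosed F] [Field E] [Algebra F E]
    (h : Cardinal.lift.{u} (Module.rank F E) < Cardinal.lift.{v} (Cardinal.mk F)) :
    Function.Surjective (algebraMap F E) := by
  have : Algebra.IsAlgebraic F E := ⟨fun x => by
    by_contra hx
    exact h.not_ge (Transcendental.linearIndependent_sub_inv hx).cardinal_lift_le_rank⟩
  exact IsAlgClosed.algebraMap_bijective_of_isIntegral.2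

/-- An algebra that is a quotient of `MvPolynomial ι F` with `ι` infinite has rank at most `#ι`. -/
theorem MvPolynomial.lift_rank_le_of_surjective {F : Type u} {ι : Type v} {E : Type*}
    [Field F] [Infinite ι] [CommRing E] [Algebra F E] (f : MvPolynomial ι F →ₐ[F] E)
    (hf : Function.Surjective f) :
    Cardinal.lift.{max u v} (Module.rank F E) ≤ Cardinal.lift (Cardinal.mk ι) := by
  refine (f.toLinearMap.lift_rank_le_of_surjective hf).trans ?_
  rw [MvPolynomial.rank_eq_lift, Cardinal.mk_finsupp_nat,
    max_eq_left (Cardinal.aleph0_le_mk ι), Cardinal.lift_lift]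

/-- A weak Nullstellensatz for algebras with an infinite generating family smaller than the
ground field. -/
theorem Ideal.IsMaximal.exists_eq_span_range_sub_of_adjoin_eq_top
    {F : Type u} {ι : Type v} {R : Type w} [Field F] [IsAlgClosed F] [Infinite ι]
    [CommRing R] [Algebra F R]
    (hcard : Cardinal.lift.{u} (Cardinal.mk ι) < Cardinal.lift.{v} (Cardinal.mk F))
    (t : ι → R) (ht : Algebra.adjoin F (Set.range t) = ⊤) {m : Ideal R} (hm : m.IsMaximal) :
    ∃ p : ι → F, m = Ideal.span (Set.range fun i => t i - p i • (1 : R)) := by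
  let _ := Ideal.Quotient.field m
  have hsurj : Function.Surjective ((Ideal.Quotient.mkₐ F m).comp (aeval t)) :=
    (Ideal.Quotient.mkₐ_surjective F m).comp <| by
      rw [AlgHom.coe_toRingHom, ← AlgHom.range_eq_top, ← Algebra.adjoin_range_eq_range_aeval, ht]
  have hrank := MvPolynomial.lift_rank_le_of_surjective _ hsurj
  have halg : Function.Surjective (algebraMap F (R ⧸ m)) := by
    apply IsAlgClosed.algebraMap_surjective_of_lift_rank_lt
    rw [← Cardinal.lift_lt.{max u w, v}]
    rw [← Cardinal.lift_lt.{max u v, w}] at hcard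
    simp only [Cardinal.lift_lift] at hrank hcard ⊢
    exact hrank.trans_lt hcard
  choose p hp using fun i => halg (Ideal.Quotient.mk m (t i))
  refine ⟨p, ?_⟩
  set J := Ideal.span (Set.range fun i => t i - p i • (1 : R))
  have hJm : J ≤ m := by
    refine Ideal.span_le.2 ?_
    rintro _ ⟨i, rfl⟩
    rw [SetLike.mem_coe, ← Ideal.Quotient.mk_eq_mk_iff_sub_mem, ← hp,
      ← Algebra.algebraMap_eq_smul_one, Ideal.Quotient.mk_algebraMap]
  have hconst : ∀ r : R, ∃ c : F, r - algebraMap F R c ∈ J := by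
    have hsub : ⊤ ≤ (⊥ : Subalgebra F (R ⧸ J)).comap (Ideal.Quotient.mkₐ F J) := by
      rw [← ht, Algebra.adjoin_le_iff]
      rintro _ ⟨i, rfl⟩
      refine Algebra.mem_bot.2 ⟨p i, ?_⟩
      change _ = Ideal.Quotient.mk J (t i)
      rw [← Ideal.Quotient.mk_algebraMap, eq_comm,
        Ideal.Quotient.mk_eq_mk_iff_sub_mem, Algebra.algebraMap_eq_smul_one]
      exact Ideal.subset_span ⟨i, rfl⟩
    intro r
    obtain ⟨c, hc⟩ := Algebra.mem_bot.1 (hsub (Algebra.mem_top : r ∈ ⊤))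
    refine ⟨c, ?_⟩
    rw [← Ideal.Quotient.mk_eq_mk_iff_sub_mem, Ideal.Quotient.mk_algebraMap, hc]
    rfl
  refine le_antisymm (fun r hr => ?_) hJm
  obtain ⟨c, hc⟩ := hconst r
  have hcm : algebraMap F R c ∈ m := by
    simpa using m.sub_mem hr (hJm hc)
  have hc0 : c = 0 := by
    by_contra hne
    exact hm.ne_top (m.eq_top_of_isUnit_mem hcm ((IsUnit.mk0 c hne).map _))
  simpa [hc0] using hc

theorem tA_apply_monomial (i : I) (s : I →₀ ℕ) (a : k) :
    (tA k I i : Module.End k (MvPolynomial I k)) (monomial s a) = s i • monomial s a :=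
  X_mul_pderiv_monomial

theorem tA_mul_comm (i j : I) : tA k I i * tA k I j = tA k I j * tA k I i := by
  refine Subtype.ext ((basisMonomials I k).ext fun s => ?_)
  simp only [coe_basisMonomials, MulMemClass.coe_mul, Module.End.mul_apply, tA_apply_monomial,
    map_nsmul]
  exact smul_comm _ _ _

theorem A0_mul_comm (a b : A0 k I) : a * b = b * a := by
  refine (Algebra.isMulCommutative_adjoin k ?_).is_comm.comm a b
  rintro _ ⟨i, rfl⟩ _ ⟨j, rfl⟩
  exact tA_mul_comm k I i j

theorem adjoin_range_tA0 : Algebra.adjoin k (Set.range (tA0 k I)) = ⊤ := by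
  refine Eq.trans (congrArg _ ?_)
    (Algebra.adjoin_adjoin_coe_preimage (R := k) (s := Set.range (tA k I)))
  ext x
  exact exists_congr fun i => Subtype.ext_iff

/-- Every maximal ideal of `A₀` has the form `m_p` for some `p : I → k`,
where `m_p` is the ideal of `A₀` generated by the elements `t i - p i • 1`. -/
theorem maximal_ideal_of_A0_eq_span [IsAlgClosed k] [CharZero k] [Infinite I]
    (hcard : Cardinal.lift.{u} (Cardinal.mk I) < Cardinal.lift.{v} (Cardinal.mk k))
    (m : Ideal (A0 k I)) (hm : m.IsMaximal) :
    ∃ p : I → k,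
      m = Ideal.span (Set.range fun i => tA0 k I i - p i • (1 : A0 k I)) := by
  let _ : CommRing (A0 k I) := { (inferInstance : Ring (A0 k I)) with mul_comm := A0_mul_comm k I }
  exact hm.exists_eq_span_range_sub_of_adjoin_eq_top hcard (tA0 k I) (adjoin_range_tA0 k I)
end
end

section
/- For every p : I → k, the module P(p) is a weight module (it is the sum of its weight spaces); its support is exactly {p + v : v ∈ I →₀ ℤ} (these weights being pairwise distinct), and each of these weight spaces of P(p) is one-dimensional over k. -/
set_option synthInstance.maxHeartbeats 1000000
set_option maxHeartbeats 4000000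

noncomputable section

open MvPolynomial

universe u v

variable (k : Type u) (I : Type v) [Field k]

/-- Shortcut instance: quotients of the Weyl algebra by left ideals (submodules). -/
instance : HasQuotient (Weyl k I) (Submodule (Weyl k I) (Weyl k I)) :=
  @Submodule.hasQuotient (Weyl k I) (Weyl k I) _ _ _

/-- The weight space of weight `p` in a module over the Weyl algebra:
all `x` with `t i • x = p i • x` for every `i`. -/
def wtSp (M : Type*) [AddCommGroup M] [Module k M] [Module (Weyl k I) M]
    [IsScalarTower k (Weyl k I) M] (p : I → k) : Submodule k M where
  carrier := {x | ∀ i, tA k I i • x = p i • x}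
  add_mem' := by
    intro a b ha hb i
    rw [smul_add, ha i, hb i, ← smul_add]
  zero_mem' := by intro i; rw [smul_zero, smul_zero]
  smul_mem' := by
    intro c x hx i
    have h : tA k I i • (c • x) = c • (tA k I i • x) := by
      rw [← algebraMap_smul (Weyl k I) c x, ← algebraMap_smul (Weyl k I) c (tA k I i • x),
        smul_smul, smul_smul, Algebra.commutes]
    rw [h, hx i, smul_smul, smul_smul, mul_comm]

/-- The left ideal `J_p` of the Weyl algebra generated by the elements `t i - p i • 1`. -/
def Jp (p : I → k) : Submodule (Weyl k I) (Weyl k I) :=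
  Submodule.span (Weyl k I) (Set.range fun i => tA k I i - p i • (1 : Weyl k I))

/-- The exponent `n + v`, truncated at zero in each coordinate. -/
def shiftExp {I : Type v} (n : I →₀ ℕ) (v : I →₀ ℤ) : I →₀ ℕ :=
  Finsupp.zipWith (fun (a : ℕ) (b : ℤ) => ((a : ℤ) + b).toNat) rfl n v

/-- The product over `i` of the falling factorials of `n i` of length the negative part of `v i`. -/
def fallCoeff {I : Type v} (v : I →₀ ℤ) (n : I →₀ ℕ) : ℕ :=
  v.prod fun i m => (n i).descFactorial (-m).toNat

lemma shiftExp_apply {I : Type v} (n : I →₀ ℕ) (v : I →₀ ℤ) (i : I) :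
    shiftExp n v i = ((n i : ℤ) + v i).toNat := by
  simp [shiftExp]

lemma fallCoeff_eq_mul_erase {I : Type v} (v : I →₀ ℤ) (n : I →₀ ℕ) (i : I) :
    fallCoeff v n = (n i).descFactorial (-(v i)).toNat * fallCoeff (v.erase i) n :=
  (Finsupp.mul_prod_erase' v i _ (fun j => by simp)).symm

lemma fallCoeff_eq_zero {I : Type v} {v : I →₀ ℤ} {n : I →₀ ℕ} {i : I}
    (h : (n i : ℤ) + v i < 0) : fallCoeff v n = 0 := by
  rw [fallCoeff_eq_mul_erase v n i, Nat.descFactorial_eq_zero_iff_lt.2 (by omega), zero_mul]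

lemma fallCoeff_ne_zero {I : Type v} {v : I →₀ ℤ} {n : I →₀ ℕ}
    (h : ∀ i, 0 ≤ (n i : ℤ) + v i) : fallCoeff v n ≠ 0 := by
  refine Finset.prod_ne_zero_iff.2 fun i _ => ?_
  have := h i
  rw [Ne, Nat.descFactorial_eq_zero_iff_lt]
  omega

/-- Evaluation of a polynomial at an exponent vector. -/
def expEval (n : I →₀ ℕ) : MvPolynomial I k →ₐ[k] k :=
  aeval fun i => (n i : k)

/-- The operator `x ^ n ↦ f(n) c_v(n) x ^ (n + v)` on the polynomial algebra, linear in `f`. -/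
def shiftOp (v : I →₀ ℤ) : MvPolynomial I k →ₗ[k] Module.End k (MvPolynomial I k) :=
  ((basisMonomials I k).constr k).toLinearMap ∘ₗ
    LinearMap.pi fun n =>
      (monomial (shiftExp n v)) ∘ₗ (LinearMap.mulRight k (fallCoeff v n : k)) ∘ₗ
        (expEval k I n).toLinearMap

lemma shiftOp_monomial (v : I →₀ ℤ) (f : MvPolynomial I k) (n : I →₀ ℕ) :
    shiftOp k I v f (monomial n 1) =
      monomial (shiftExp n v) (expEval k I n f * fallCoeff v n) := by
  have h := (basisMonomials I k).constr_basis k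
    (fun n => monomial (shiftExp n v) (expEval k I n f * (fallCoeff v n : k))) n
  rw [coe_basisMonomials] at h
  exact h

lemma end_ext_monomial {S T : Module.End k (MvPolynomial I k)}
    (h : ∀ n : I →₀ ℕ, S (monomial n 1) = T (monomial n 1)) : S = T :=
  (basisMonomials I k).ext fun n => by simpa using h n

/-- The polynomial correcting the coefficient when `X i` is applied to a shift operator. -/
def raiseFactor (i : I) (m : ℤ) : MvPolynomial I k :=
  if 0 ≤ m then 1 else X i + C ((m : k) + 1)

/-- The polynomial correcting the coefficient when `Y i` is applied to a shift operator. -/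
def lowerFactor (i : I) (m : ℤ) : MvPolynomial I k :=
  if m ≤ 0 then 1 else X i + C (m : k)

lemma fallCoeff_raise (i : I) (v : I →₀ ℤ) (n : I →₀ ℕ) :
    (fallCoeff v n : k) =
      expEval k I n (raiseFactor k I i (v i)) * fallCoeff (v + Finsupp.single i 1) n := by
  rw [fallCoeff_eq_mul_erase v n i, fallCoeff_eq_mul_erase (v + Finsupp.single i 1) n i]
  have he : (v + Finsupp.single i 1).erase i = v.erase i := by simp [Finsupp.erase_add]
  rw [he, Nat.cast_mul, Nat.cast_mul, ← mul_assoc]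
  congr 1
  simp only [Finsupp.add_apply, Finsupp.single_eq_same, raiseFactor]
  split_ifs with h
  · have h1 : (-(v i)).toNat = 0 := by omega
    have h2 : (-(v i + 1)).toNat = 0 := by omega
    rw [h1, h2]
    simp
  · obtain ⟨r, hr⟩ : ∃ r : ℕ, v i = -(r + 1 : ℤ) := ⟨(-(v i) - 1).toNat, by omega⟩
    have h1 : (-(v i)).toNat = r + 1 := by omega
    have h2 : (-(v i + 1)).toNat = r := by omega
    rw [h1, h2, Nat.descFactorial_succ, Nat.cast_mul]
    rcases lt_or_ge (n i) r with hlt | hge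
    · simp [Nat.descFactorial_eq_zero_iff_lt.2 hlt]
    · congr 1
      rw [Nat.cast_sub hge, hr]
      simp [expEval]
      ring

lemma fallCoeff_lower (i : I) (v : I →₀ ℤ) (n : I →₀ ℕ) :
    (fallCoeff v n : k) * (shiftExp n v i : k) =
      expEval k I n (lowerFactor k I i (v i)) * fallCoeff (v - Finsupp.single i 1) n := by
  rw [fallCoeff_eq_mul_erase v n i, fallCoeff_eq_mul_erase (v - Finsupp.single i 1) n i]
  have he : (v - Finsupp.single i 1).erase i = v.erase i := by
    simp [sub_eq_add_neg, Finsupp.erase_add, ← Finsupp.single_neg]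
  rw [he, Nat.cast_mul, Nat.cast_mul, ← mul_assoc, mul_right_comm]
  congr 1
  simp only [Finsupp.sub_apply, Finsupp.single_eq_same, lowerFactor, shiftExp_apply]
  split_ifs with h
  · obtain ⟨r, hr⟩ : ∃ r : ℕ, v i = -(r : ℤ) := ⟨(-(v i)).toNat, by omega⟩
    have h1 : (-(v i)).toNat = r := by omega
    have h2 : (-(v i - 1)).toNat = r + 1 := by omega
    have h3 : ((n i : ℤ) + v i).toNat = n i - r := by omega
    rw [h1, h2, h3, Nat.descFactorial_succ, Nat.cast_mul]
    simp [mul_comm]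
  · obtain ⟨r, hr⟩ : ∃ r : ℕ, v i = (r : ℤ) := ⟨(v i).toNat, by omega⟩
    have h1 : (-(v i)).toNat = 0 := by omega
    have h2 : (-(v i - 1)).toNat = 0 := by omega
    have h3 : ((n i : ℤ) + v i).toNat = n i + r := by omega
    rw [h1, h2, h3, hr]
    simp [expEval]

lemma Xop_mul_shiftOp (i : I) (v : I →₀ ℤ) (f : MvPolynomial I k) :
    Xop k I i * shiftOp k I v f =
      shiftOp k I (v + Finsupp.single i 1) (f * raiseFactor k I i (v i)) := by
  refine end_ext_monomial k I fun n => ?_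
  rw [Module.End.mul_apply, shiftOp_monomial, shiftOp_monomial, map_mul (expEval k I n), mul_assoc,
    ← fallCoeff_raise]
  rcases lt_or_ge ((n i : ℤ) + v i) 0 with h | h
  · simp [fallCoeff_eq_zero h]
  · have hs : shiftExp n (v + Finsupp.single i 1) = shiftExp n v + Finsupp.single i 1 := by
      ext j
      rw [Finsupp.add_apply, shiftExp_apply, shiftExp_apply, Finsupp.add_apply]
      rcases eq_or_ne j i with rfl | hj
      · simp only [Finsupp.single_eq_same]; omega
      · simp [Finsupp.single_eq_of_ne hj]
    rw [hs, Xop, LinearMap.mulLeft_apply, X, monomial_mul, one_mul, add_comm]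

lemma Yop_mul_shiftOp (i : I) (v : I →₀ ℤ) (f : MvPolynomial I k) :
    Yop k I i * shiftOp k I v f =
      shiftOp k I (v - Finsupp.single i 1) (f * lowerFactor k I i (v i)) := by
  refine end_ext_monomial k I fun n => ?_
  rw [Module.End.mul_apply, shiftOp_monomial, shiftOp_monomial, map_mul (expEval k I n), mul_assoc,
    ← fallCoeff_lower]
  have hs : shiftExp n (v - Finsupp.single i 1) = shiftExp n v - Finsupp.single i 1 := by
    ext j
    rw [Finsupp.tsub_apply, shiftExp_apply, shiftExp_apply, Finsupp.sub_apply]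
    rcases eq_or_ne j i with rfl | hj
    · simp only [Finsupp.single_eq_same]; omega
    · simp [Finsupp.single_eq_of_ne hj]
  rw [hs, Yop, Derivation.coeFn_coe, pderiv_monomial, mul_assoc]

lemma shiftOp_mul_t (i : I) (v : I →₀ ℤ) (f : MvPolynomial I k) :
    shiftOp k I v f * (Xop k I i * Yop k I i) = shiftOp k I v (f * X i) := by
  refine end_ext_monomial k I fun n => ?_
  have ht : (Xop k I i * Yop k I i) (monomial n 1) = (n i : k) • monomial n 1 := by
    rw [Module.End.mul_apply, Xop, Yop, LinearMap.mulLeft_apply, Derivation.coeFn_coe,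
      X_mul_pderiv_monomial, Nat.cast_smul_eq_nsmul]
  rw [Module.End.mul_apply, ht, map_smul, shiftOp_monomial, shiftOp_monomial, smul_monomial]
  congr 1
  simp [expEval]
  ring

lemma t_mul_shiftOp (i : I) (v : I →₀ ℤ) (f : MvPolynomial I k) :
    (Xop k I i * Yop k I i) * shiftOp k I v f = shiftOp k I v (f * (X i + C ((v i : ℤ) : k))) := by
  rw [mul_assoc, Yop_mul_shiftOp, Xop_mul_shiftOp, sub_add_cancel, mul_assoc]
  congr 2
  simp only [raiseFactor, lowerFactor, Finsupp.sub_apply, Finsupp.single_eq_same]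
  split_ifs <;> first | omega | simp

lemma shiftOp_zero_one : shiftOp k I 0 1 = 1 := by
  refine end_ext_monomial k I fun n => ?_
  have hs : shiftExp n 0 = n := by ext j; simp [shiftExp_apply]
  simp [shiftOp_monomial, hs, fallCoeff]

lemma shiftOp_one_mem (v : I →₀ ℤ) : shiftOp k I v 1 ∈ Weyl k I := by
  induction v using Finsupp.induction with
  | zero => rw [shiftOp_zero_one]; exact one_mem _
  | single_add i m v hi hm hv =>
    clear hm
    rw [Finsupp.notMem_support_iff] at hi
    induction m using Int.induction_on with
    | zero => simpa using hv
    | succ m ih =>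
      have h := mul_mem (XA k I i).2 ih
      simp only [XA] at h
      rw [Xop_mul_shiftOp, raiseFactor, if_pos (by simp [hi]), mul_one, add_right_comm,
        ← Finsupp.single_add] at h
      exact h
    | pred m ih =>
      have h := mul_mem (YA k I i).2 ih
      simp only [YA] at h
      rw [Yop_mul_shiftOp, lowerFactor, if_pos (by simp [hi]), mul_one, add_sub_right_comm,
        ← Finsupp.single_sub] at h
      exact h

lemma shiftOp_mem (v : I →₀ ℤ) (f : MvPolynomial I k) : shiftOp k I v f ∈ Weyl k I := by
  induction f using MvPolynomial.induction_on with
  | C a =>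
    rw [← mul_one (C a), ← smul_eq_C_mul, map_smul]
    exact Subalgebra.smul_mem _ (shiftOp_one_mem k I v) a
  | add f g hf hg => rw [map_add]; exact add_mem hf hg
  | mul_X f i hf => rw [← shiftOp_mul_t]; exact mul_mem hf (tA k I i).2

/-- The sum of the shift operators with given polynomial coefficients, in the Weyl algebra. -/
def sumOp : ((I →₀ ℤ) →₀ MvPolynomial I k) →ₗ[k] Weyl k I :=
  Finsupp.lsum k fun v =>
    (shiftOp k I v).codRestrict (Subalgebra.toSubmodule (Weyl k I)) (shiftOp_mem k I v)

lemma sumOp_single (v : I →₀ ℤ) (f : MvPolynomial I k) :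
    (sumOp k I (Finsupp.single v f) : Module.End k (MvPolynomial I k)) = shiftOp k I v f := by
  rw [sumOp, Finsupp.lsum_single]
  rfl

lemma coe_sumOp (G : (I →₀ ℤ) →₀ MvPolynomial I k) :
    (sumOp k I G : Module.End k (MvPolynomial I k)) = G.sum fun v f => shiftOp k I v f := by
  induction G using Finsupp.induction_linear with
  | zero => simp
  | add F G hF hG =>
    rw [map_add, Finsupp.sum_add_index' (by simp) (by simp), ← hF, ← hG]
    rfl
  | single v f => rw [sumOp_single, Finsupp.sum_single_index (h := fun v f => shiftOp k I v f) (map_zero _)]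

lemma exists_sumOp_eq_mul (S : Module.End k (MvPolynomial I k))
    (hS : ∀ v f, ∃ w g, S * shiftOp k I v f = shiftOp k I w g)
    (G : (I →₀ ℤ) →₀ MvPolynomial I k) :
    ∃ H, S * (sumOp k I G : Module.End k (MvPolynomial I k)) = sumOp k I H := by
  induction G using Finsupp.induction_linear with
  | zero => exact ⟨0, by simp⟩
  | add F G hF hG =>
    obtain ⟨F', hF⟩ := hF
    obtain ⟨G', hG⟩ := hG
    refine ⟨F' + G', ?_⟩
    rw [map_add, map_add]
    push_cast
    rw [mul_add, hF, hG]
  | single v f =>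
    obtain ⟨w, g, h⟩ := hS v f
    exact ⟨Finsupp.single w g, by rw [sumOp_single, sumOp_single, h]⟩

lemma sumOp_surjective : Function.Surjective (sumOp k I) := by
  suffices h : ∀ S ∈ Weyl k I, ∀ G, ∃ H,
      S * (sumOp k I G : Module.End k (MvPolynomial I k)) = sumOp k I H by
    rintro ⟨S, hS⟩
    obtain ⟨H, hH⟩ := h S hS (Finsupp.single 0 1)
    rw [sumOp_single, shiftOp_zero_one, mul_one] at hH
    exact ⟨H, Subtype.ext hH.symm⟩
  intro S hS
  induction hS using Algebra.adjoin_induction with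
  | mem S hS =>
    rcases hS with ⟨i, rfl⟩ | ⟨i, rfl⟩
    · exact exists_sumOp_eq_mul k I _ fun v f => ⟨_, _, Xop_mul_shiftOp k I i v f⟩
    · exact exists_sumOp_eq_mul k I _ fun v f => ⟨_, _, Yop_mul_shiftOp k I i v f⟩
  | algebraMap r =>
    intro G
    refine ⟨r • G, ?_⟩
    rw [map_smul, ← Algebra.smul_def]
    rfl
  | add S T _ _ hS hT =>
    intro G
    obtain ⟨F, hF⟩ := hS G
    obtain ⟨H, hH⟩ := hT G
    refine ⟨F + H, ?_⟩
    rw [add_mul, hF, hH, map_add]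
    rfl
  | mul S T _ _ hS hT =>
    intro G
    obtain ⟨F, hF⟩ := hT G
    obtain ⟨H, hH⟩ := hS F
    exact ⟨H, by rw [mul_assoc, hF, hH]⟩

lemma coeff_sumOp_monomial (G : (I →₀ ℤ) →₀ MvPolynomial I k) (v : I →₀ ℤ) (n : I →₀ ℕ)
    (hn : ∀ i, 0 ≤ (n i : ℤ) + v i) :
    coeff (shiftExp n v) ((sumOp k I G : Module.End k (MvPolynomial I k)) (monomial n 1)) =
      expEval k I n (G v) * fallCoeff v n := by
  classical
  rw [coe_sumOp, Finsupp.sum, LinearMap.sum_apply, coeff_sum, Finset.sum_eq_single v]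
  · rw [shiftOp_monomial, coeff_monomial, if_pos rfl]
  · intro w _ hw
    rw [shiftOp_monomial, coeff_monomial]
    split_ifs with h
    · obtain ⟨i, hi⟩ : ∃ i, w i ≠ v i := by
        by_contra! h'
        exact hw (Finsupp.ext h')
      have h1 := DFunLike.congr_fun h i
      rw [shiftExp_apply, shiftExp_apply] at h1
      have h2 := hn i
      by_cases h3 : (n i : ℤ) + w i < 0
      · simp [fallCoeff_eq_zero h3]
      · omega
    · rfl
  · intro h
    rw [Finsupp.notMem_support_iff.1 h]
    simp

lemma eq_zero_of_expEval_eq_zero [CharZero k] (f : MvPolynomial I k) (v : I →₀ ℤ)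
    (h : ∀ n : I →₀ ℕ, (∀ i, 0 ≤ (n i : ℤ) + v i) → expEval k I n f = 0) : f = 0 := by
  classical
  refine MvPolynomial.funext_set
    (fun i => (fun m : ℕ => (m : k)) '' Set.Ici (-(v i)).toNat)
    (fun i => (Set.Ici_infinite _).image Nat.cast_injective.injOn) ?_
  intro x hx
  choose m hm hmx using fun i => hx i (Set.mem_univ i)
  let n : I →₀ ℕ := Finsupp.onFinset (f.vars ∪ v.support)
    (fun i => if i ∈ f.vars ∪ v.support then m i else 0) (by
      intro i hi
      by_contra h'
      exact hi (if_neg h'))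
  have hn := h n fun i => by
    have := hm i
    simp only [Set.mem_Ici] at this
    by_cases hi : i ∈ f.vars ∪ v.support
    · simp only [n, Finsupp.onFinset_apply, if_pos hi]; omega
    · have : v i = 0 := by
        by_contra h'
        exact hi (Finset.mem_union_right _ (Finsupp.mem_support_iff.2 h'))
      omega
  rw [map_zero, ← hn]
  refine eval₂Hom_congr' rfl (fun i hi _ => ?_) rfl
  rw [← hmx i]
  simp [n, hi]

lemma sumOp_injective [CharZero k] : Function.Injective (sumOp k I) := by
  rw [← LinearMap.ker_eq_bot, LinearMap.ker_eq_bot']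
  intro G hG
  ext1 v
  refine eq_zero_of_expEval_eq_zero k I _ v fun n hn => ?_
  have h := coeff_sumOp_monomial k I G v n hn
  rw [hG] at h
  exact (mul_eq_zero.1 (h.symm.trans (by simp))).resolve_right
    (Nat.cast_ne_zero.2 (fallCoeff_ne_zero hn))

/-- The coefficients of an element of the Weyl algebra in terms of shift operators,
evaluated at `p`. -/
def evalCoeffs [CharZero k] (p : I → k) : Weyl k I →ₗ[k] (I →₀ ℤ) →₀ k :=
  Finsupp.mapRange.linearMap (aeval p).toLinearMap ∘ₗ
    (LinearEquiv.ofBijective (sumOp k I) ⟨sumOp_injective k I, sumOp_surjective k I⟩).symm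

lemma evalCoeffs_sumOp [CharZero k] (p : I → k) (G : (I →₀ ℤ) →₀ MvPolynomial I k) :
    evalCoeffs k I p (sumOp k I G) = Finsupp.mapRange.linearMap (aeval p).toLinearMap G := by
  rw [evalCoeffs, LinearMap.comp_apply, LinearEquiv.coe_coe]
  congr 1
  exact (LinearEquiv.ofBijective (sumOp k I) _).symm_apply_apply G

lemma sumOp_single_mul_tA (i : I) (v : I →₀ ℤ) (f : MvPolynomial I k) :
    sumOp k I (Finsupp.single v f) * tA k I i = sumOp k I (Finsupp.single v (f * X i)) := by
  apply Subtype.ext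
  rw [sumOp_single, ← shiftOp_mul_t, ← sumOp_single]
  rfl

lemma tA_mul_sumOp_single (i : I) (v : I →₀ ℤ) (f : MvPolynomial I k) :
    tA k I i * sumOp k I (Finsupp.single v f) =
      sumOp k I (Finsupp.single v (f * (X i + C ((v i : ℤ) : k)))) := by
  apply Subtype.ext
  rw [sumOp_single, ← t_mul_shiftOp, ← sumOp_single]
  rfl

lemma evalCoeffs_mul_tA [CharZero k] (p : I → k) (a : Weyl k I) (i : I) :
    evalCoeffs k I p (a * tA k I i) = p i • evalCoeffs k I p a := by
  obtain ⟨G, rfl⟩ := sumOp_surjective k I a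
  induction G using Finsupp.induction_linear with
  | zero => simp
  | add F G hF hG => rw [map_add, add_mul, map_add, hF, hG, map_add, smul_add]
  | single v f =>
    rw [sumOp_single_mul_tA, evalCoeffs_sumOp, evalCoeffs_sumOp, Finsupp.mapRange.linearMap_apply,
      Finsupp.mapRange.linearMap_apply, Finsupp.mapRange_single, Finsupp.mapRange_single,
      Finsupp.smul_single, AlgHom.toLinearMap_apply, AlgHom.toLinearMap_apply, map_mul, aeval_X,
      smul_eq_mul, mul_comm]

lemma evalCoeffs_eq_zero_of_mem [CharZero k] {p : I → k} {a : Weyl k I} (ha : a ∈ Jp k I p) :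
    evalCoeffs k I p a = 0 := by
  induction ha using Submodule.closure_induction with
  | zero => exact map_zero _
  | add x y _ _ hx hy => rw [map_add, hx, hy, add_zero]
  | smul_mem r x hx =>
    obtain ⟨i, rfl⟩ := hx
    rw [smul_eq_mul, mul_sub, map_sub, evalCoeffs_mul_tA, mul_smul_comm, mul_one, map_smul,
      sub_self]

/-- The class in `P(p)` of the shift operator with exponent `v`. -/
def wtVec (p : I → k) (v : I →₀ ℤ) : Weyl k I ⧸ Jp k I p :=
  Submodule.Quotient.mk (sumOp k I (Finsupp.single v 1))

lemma mk_mul_tA (p : I → k) (a : Weyl k I) (i : I) :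
    (Submodule.Quotient.mk (a * tA k I i) : Weyl k I ⧸ Jp k I p) =
      p i • Submodule.Quotient.mk a := by
  rw [← Submodule.Quotient.mk_smul, Submodule.Quotient.eq]
  have h : a * tA k I i - p i • a = a • (tA k I i - p i • (1 : Weyl k I)) := by
    rw [smul_eq_mul, mul_sub, mul_smul_comm, mul_one]
  rw [h]
  exact Submodule.smul_mem _ _ (Submodule.subset_span ⟨i, rfl⟩)

lemma mk_sumOp_single (p : I → k) (v : I →₀ ℤ) (f : MvPolynomial I k) :
    (Submodule.Quotient.mk (sumOp k I (Finsupp.single v f)) : Weyl k I ⧸ Jp k I p) =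
      aeval p f • wtVec k I p v := by
  induction f using MvPolynomial.induction_on with
  | C a =>
    rw [← mul_one (C a), ← smul_eq_C_mul, ← Finsupp.smul_single, map_smul,
      Submodule.Quotient.mk_smul, map_smul, map_one, smul_eq_mul, mul_one, wtVec]
  | add f g hf hg =>
    rw [Finsupp.single_add, map_add, Submodule.Quotient.mk_add, hf, hg, map_add, add_smul]
  | mul_X f i hf =>
    rw [← sumOp_single_mul_tA, mk_mul_tA, hf, map_mul, aeval_X, smul_smul, mul_comm]

lemma mk_eq_linearCombination [CharZero k] (p : I → k) (a : Weyl k I) :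
    (Submodule.Quotient.mk a : Weyl k I ⧸ Jp k I p) =
      Finsupp.linearCombination k (wtVec k I p) (evalCoeffs k I p a) := by
  obtain ⟨G, rfl⟩ := sumOp_surjective k I a
  induction G using Finsupp.induction_linear with
  | zero => simp
  | add F G hF hG => rw [map_add, Submodule.Quotient.mk_add, hF, hG, map_add, map_add]
  | single v f =>
    rw [mk_sumOp_single, evalCoeffs_sumOp]
    simp

lemma linearCombination_wtVec_surjective [CharZero k] (p : I → k) :
    Function.Surjective (Finsupp.linearCombination k (wtVec k I p)) := by
  intro y
  obtain ⟨a, rfl⟩ := Submodule.Quotient.mk_surjective _ y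
  exact ⟨_, (mk_eq_linearCombination k I p a).symm⟩

lemma evalCoeffs_surjective [CharZero k] (p : I → k) :
    Function.Surjective (evalCoeffs k I p) := by
  intro x
  refine ⟨sumOp k I (Finsupp.mapRange.linearMap (Algebra.linearMap k (MvPolynomial I k)) x), ?_⟩
  rw [evalCoeffs_sumOp]
  ext v
  simp

lemma linearIndependent_wtVec [CharZero k] (p : I → k) :
    LinearIndependent k (wtVec k I p) := by
  rw [linearIndependent_iff]
  intro x hx
  obtain ⟨a, rfl⟩ := evalCoeffs_surjective k I p x
  rw [← mk_eq_linearCombination, Submodule.Quotient.mk_eq_zero] at hx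
  exact evalCoeffs_eq_zero_of_mem k I hx

lemma tA_smul_wtVec (p : I → k) (i : I) (v : I →₀ ℤ) :
    tA k I i • wtVec k I p v = (p i + ((v i : ℤ) : k)) • wtVec k I p v := by
  rw [wtVec, ← Submodule.Quotient.mk_smul, smul_eq_mul, tA_mul_sumOp_single, mk_sumOp_single]
  simp [wtVec]

lemma wtVec_mem (p : I → k) (v : I →₀ ℤ) :
    wtVec k I p v ∈ wtSp k I (Weyl k I ⧸ Jp k I p) fun i => p i + ((v i : ℤ) : k) :=
  fun i => tA_smul_wtVec k I p i v

lemma tA_smul_linearCombination (p : I → k) (i : I) (x : (I →₀ ℤ) →₀ k) :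
    tA k I i • Finsupp.linearCombination k (wtVec k I p) x =
      Finsupp.linearCombination k (wtVec k I p)
        (Finsupp.lsum k (fun v : I →₀ ℤ =>
          (p i + ((v i : ℤ) : k)) • Finsupp.lsingle (R := k) v) x) := by
  induction x using Finsupp.induction_linear with
  | zero => simp
  | add x y hx hy => rw [map_add, smul_add, hx, hy, map_add, map_add]
  | single v c =>
    have h : tA k I i • c • wtVec k I p v = c • tA k I i • wtVec k I p v := by
      rw [← algebraMap_smul (Weyl k I) c, ← algebraMap_smul (Weyl k I) c (tA k I i • _),
        smul_smul, smul_smul, Algebra.commutes]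
    rw [Finsupp.lsum_single, LinearMap.smul_apply, Finsupp.lsingle_apply, map_smul,
      Finsupp.linearCombination_single, h, tA_smul_wtVec, smul_comm]

lemma weight_eq_of_linearCombination_mem [CharZero k] {p q : I → k} {x : (I →₀ ℤ) →₀ k}
    (hx : Finsupp.linearCombination k (wtVec k I p) x ∈ wtSp k I (Weyl k I ⧸ Jp k I p) q)
    {v : I →₀ ℤ} (hv : x v ≠ 0) : q = fun i => p i + ((v i : ℤ) : k) := by
  classical
  funext i
  have h := hx i
  rw [tA_smul_linearCombination, ← map_smul] at h
  have h' := DFunLike.congr_fun (linearIndependent_wtVec k I p h) v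
  rw [Finsupp.lsum_apply, Finsupp.sum, Finsupp.finsetSum_apply, Finset.sum_eq_single v] at h'
  · simp only [LinearMap.smul_apply, Finsupp.lsingle_apply, Finsupp.smul_apply,
      Finsupp.single_eq_same, smul_eq_mul] at h'
    exact (mul_right_cancel₀ hv h').symm
  · intro w _ hw
    simp [Finsupp.single_eq_of_ne hw.symm]
  · intro h
    exact absurd (Finsupp.notMem_support_iff.1 h) hv

lemma intCast_weight_injective [CharZero k] (p : I → k) {v w : I →₀ ℤ}
    (h : (fun i => p i + ((v i : ℤ) : k)) = fun i => p i + ((w i : ℤ) : k)) : v = w :=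
  Finsupp.ext fun i => Int.cast_injective (add_left_cancel (congrFun h i))

/-- `P(p) = A ⧸ J_p` is a weight module, its support is exactly
`{p + v : v ∈ I →₀ ℤ}`, these weights are pairwise distinct, and each of these weight
spaces is one-dimensional over `k`. -/
theorem Pp_weight_structure [IsAlgClosed k] [CharZero k] [Infinite I] (p : I → k) :
    (⨆ q : I → k, wtSp k I (Weyl k I ⧸ Jp k I p) q) = ⊤ ∧
    (∀ q : I → k,
      wtSp k I (Weyl k I ⧸ Jp k I p) q ≠ ⊥ ↔
        ∃ v : I →₀ ℤ, q = fun i => p i + ((v i : ℤ) : k)) ∧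
    (∀ v w : I →₀ ℤ,
      (fun i => p i + ((v i : ℤ) : k)) = (fun i => p i + ((w i : ℤ) : k)) → v = w) ∧
    (∀ v : I →₀ ℤ,
      Module.finrank k
        (wtSp k I (Weyl k I ⧸ Jp k I p) fun i => p i + ((v i : ℤ) : k)) = 1) := by
  have hmem : ∀ v, wtVec k I p v ∈
      wtSp k I (Weyl k I ⧸ Jp k I p) fun i => p i + ((v i : ℤ) : k) := wtVec_mem k I p
  have hne : ∀ v, wtVec k I p v ≠ 0 := (linearIndependent_wtVec k I p).ne_zero
  refine ⟨?_, fun q => ⟨fun hq => ?_, ?_⟩, fun v w => intCast_weight_injective k I p, fun v => ?_⟩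
  · refine eq_top_iff.2 fun y _ => ?_
    obtain ⟨x, rfl⟩ := linearCombination_wtVec_surjective k I p y
    rw [Finsupp.linearCombination_apply]
    exact Submodule.sum_mem _ fun v _ => Submodule.smul_mem _ _
      (Submodule.mem_iSup_of_mem (fun i => p i + ((v i : ℤ) : k)) (hmem v))
  · obtain ⟨y, hy, hy0⟩ := Submodule.exists_mem_ne_zero_of_ne_bot hq
    obtain ⟨x, rfl⟩ := linearCombination_wtVec_surjective k I p y
    obtain ⟨v, hv⟩ : ∃ v, x v ≠ 0 := by
      by_contra! h
      exact hy0 (by rw [Finsupp.ext (g := 0) h, map_zero])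
    exact ⟨v, weight_eq_of_linearCombination_mem k I hy hv⟩
  · rintro ⟨v, rfl⟩ hbot
    exact hne v ((Submodule.eq_bot_iff _).1 hbot _ (hmem v))
  · refine finrank_eq_one (⟨wtVec k I p v, hmem v⟩ : wtSp k I (Weyl k I ⧸ Jp k I p) _)
      (fun h => hne v (congrArg Subtype.val h)) ?_
    rintro ⟨y, hy⟩
    obtain ⟨x, rfl⟩ := linearCombination_wtVec_surjective k I p y
    have hx : x = Finsupp.single v (x v) := by
      ext w
      rcases eq_or_ne w v with rfl | hw
      · simp
      · rw [Finsupp.single_eq_of_ne hw]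
        by_contra h
        exact hw (intCast_weight_injective k I p
          (weight_eq_of_linearCombination_mem k I hy h).symm)
    refine ⟨x v, Subtype.ext ?_⟩
    change x v • wtVec k I p v = Finsupp.linearCombination k (wtVec k I p) x
    rw [hx, Finsupp.linearCombination_single, Finsupp.single_eq_same]
end
end
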